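/- Let 𝒞 be a triangulated category with a proper class ξ of triangles and enough ξ-projectives. If G₁ → G₀ → A → ΣG₁ is a triangle in ξ with G₀, G₁ ∈ 𝒢𝒫(ξ), then there exist triangles P → G₀′ → A → ΣP and G₁′ → Q → A → ΣG₁′ in ξ with P, Q ξ-projective and G₀′, G₁′ ∈ 𝒢𝒫(ξ). -/

import Mathlib

open CategoryTheory CategoryTheory.Limits CategoryTheory.Pretriangulated

namespace GorensteinTriangulated

variable {C : Type*} [Category C] [HasZeroObject C] [HasShift C ℤ] [Preadditive C]
  [∀ n : ℤ, (shiftFunctor C n).Additive] [Pretriangulated C]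

/-- A triangle `A ⟶ B ⟶ C ⟶ ΣA` is split if it is isomorphic to the triangle
`A ⟶ A ⊞ C ⟶ C ⟶ ΣA` with structure maps `(1 0)`, `(0 1)ᵀ` and `0`. -/
def IsSplitTriangle (T : Triangle C) : Prop :=
  Nonempty (T ≅ Triangle.mk (biprod.inl : T.obj₁ ⟶ T.obj₁ ⊞ T.obj₃) biprod.snd
    (0 : T.obj₃ ⟶ T.obj₁⟦(1 : ℤ)⟧))

/-- The triangle `T` becomes a short exact sequence after applying `Hom(Q, -)`. -/
def CoExact (T : Triangle C) (Q : C) : Prop :=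
  Function.Injective (fun φ : Q ⟶ T.obj₁ => φ ≫ T.mor₁) ∧
  (∀ φ : Q ⟶ T.obj₂, φ ≫ T.mor₂ = 0 → ∃ ψ : Q ⟶ T.obj₁, φ = ψ ≫ T.mor₁) ∧
  Function.Surjective (fun φ : Q ⟶ T.obj₂ => φ ≫ T.mor₂)

/-- The triangle `T` becomes a short exact sequence after applying `Hom(-, Q)`. -/
def ContraExact (T : Triangle C) (Q : C) : Prop :=
  Function.Injective (fun φ : T.obj₃ ⟶ Q => T.mor₂ ≫ φ) ∧
  (∀ φ : T.obj₂ ⟶ Q, T.mor₁ ≫ φ = 0 → ∃ ψ : T.obj₃ ⟶ Q, φ = T.mor₂ ≫ ψ) ∧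
  Function.Surjective (fun φ : T.obj₂ ⟶ Q => T.mor₁ ≫ φ)

/-- Saturation of a class of triangles with respect to base change: in a base change
diagram, if the third vertical triangle and the second horizontal triangle are in `S`,
then the original triangle is in `S`. -/
def SaturatedBase (S : Set (Triangle C)) : Prop :=
  ∀ T ∈ (distinguishedTriangles : Set (Triangle C)),
    ∀ (M G E : C) (α : M ⟶ G) (δ : M ⟶ E) (f' : T.obj₁ ⟶ G) (g' : G ⟶ E)
      (h' : E ⟶ T.obj₁⟦(1 : ℤ)⟧) (β : G ⟶ T.obj₂) (ε : E ⟶ T.obj₃)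
      (γ : T.obj₂ ⟶ M⟦(1 : ℤ)⟧) (ζ : T.obj₃ ⟶ M⟦(1 : ℤ)⟧),
      Triangle.mk α β γ ∈ (distinguishedTriangles : Set (Triangle C)) →
      Triangle.mk f' g' h' ∈ S → Triangle.mk δ ε ζ ∈ S →
      α ≫ g' = δ → f' ≫ β = T.mor₁ → g' ≫ ε = β ≫ T.mor₂ → h' = ε ≫ T.mor₃ →
      T.mor₂ ≫ ζ = γ → T ∈ S

/-- Saturation of a class of triangles with respect to cobase change: in a cobase change
diagram, if the second vertical triangle and the third horizontal triangle are in `S`,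
then the original triangle is in `S`. -/
def SaturatedCobase (S : Set (Triangle C)) : Prop :=
  ∀ T ∈ (distinguishedTriangles : Set (Triangle C)),
    ∀ (N D F : C) (ζ : N ⟶ T.obj₁) (δ : N ⟶ T.obj₂) (α : T.obj₁ ⟶ D) (β : T.obj₂ ⟶ F)
      (f' : D ⟶ F) (g' : F ⟶ T.obj₃) (h' : T.obj₃ ⟶ D⟦(1 : ℤ)⟧)
      (η : D ⟶ N⟦(1 : ℤ)⟧) (υ : F ⟶ N⟦(1 : ℤ)⟧),
      Triangle.mk ζ α η ∈ (distinguishedTriangles : Set (Triangle C)) →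
      Triangle.mk δ β υ ∈ S → Triangle.mk f' g' h' ∈ S →
      ζ ≫ T.mor₁ = δ → T.mor₁ ≫ β = α ≫ f' → T.mor₂ = β ≫ g' →
      T.mor₃ ≫ (shiftFunctor C (1 : ℤ)).map α = h' → f' ≫ υ = η → T ∈ S

/-- A proper class of triangles in the sense of Beligiannis. -/
structure IsProperClass (S : Set (Triangle C)) : Prop where
  subset_dist : S ⊆ (distinguishedTriangles : Set (Triangle C))
  split_mem : ∀ T : Triangle C, T ∈ (distinguishedTriangles : Set (Triangle C)) →
    IsSplitTriangle T → T ∈ S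
  iso_closed : ∀ T₁ T₂ : Triangle C, Nonempty (T₁ ≅ T₂) → T₁ ∈ S → T₂ ∈ S
  sum_closed : ∀ T₁ ∈ S, ∀ T₂ ∈ S, ∀ T ∈ (distinguishedTriangles : Set (Triangle C)),
    Nonempty (T.obj₁ ≅ T₁.obj₁ ⊞ T₂.obj₁) →
    (∀ e₁ : T.obj₁ ≅ T₁.obj₁ ⊞ T₂.obj₁, ∀ e₂ : T.obj₂ ≅ T₁.obj₂ ⊞ T₂.obj₂,
      ∀ e₃ : T.obj₃ ≅ T₁.obj₃ ⊞ T₂.obj₃,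
      T.mor₁ = e₁.hom ≫ biprod.map T₁.mor₁ T₂.mor₁ ≫ e₂.inv →
      T.mor₂ = e₂.hom ≫ biprod.map T₁.mor₂ T₂.mor₂ ≫ e₃.inv →
      T.mor₃ = e₃.hom ≫ biprod.desc
        (T₁.mor₃ ≫ (shiftFunctor C (1 : ℤ)).map (biprod.inl ≫ e₁.inv))
        (T₂.mor₃ ≫ (shiftFunctor C (1 : ℤ)).map (biprod.inr ≫ e₁.inv)) → T ∈ S)
  susp_closed : ∀ T ∈ S, ∀ i : ℤ, (Triangle.shiftFunctor C i).obj T ∈ S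
  saturated : SaturatedBase S
  base_change : ∀ T ∈ S, ∀ {E : C} (ε : E ⟶ T.obj₃),
    ∃ (G : C) (f' : T.obj₁ ⟶ G) (g' : G ⟶ E) (h' : E ⟶ T.obj₁⟦(1 : ℤ)⟧) (β : G ⟶ T.obj₂),
      Triangle.mk f' g' h' ∈ S ∧ f' ≫ β = T.mor₁ ∧ g' ≫ ε = β ≫ T.mor₂ ∧ h' = ε ≫ T.mor₃
  cobase_change : ∀ T ∈ S, ∀ {D : C} (α : T.obj₁ ⟶ D),
    ∃ (F : C) (f' : D ⟶ F) (g' : F ⟶ T.obj₃) (h' : T.obj₃ ⟶ D⟦(1 : ℤ)⟧) (β : T.obj₂ ⟶ F),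
      Triangle.mk f' g' h' ∈ S ∧ T.mor₁ ≫ β = α ≫ f' ∧ T.mor₂ = β ≫ g' ∧
      T.mor₃ ≫ (shiftFunctor C (1 : ℤ)).map α = h'

/-- `P` is a `ξ`-projective object. -/
def XiProjective (S : Set (Triangle C)) (P : C) : Prop :=
  ∀ T ∈ S, CoExact T P

/-- `𝒞` has enough `ξ`-projectives. -/
def HasEnoughXiProjectives (S : Set (Triangle C)) : Prop :=
  ∀ A : C, ∃ (K P : C) (f : K ⟶ P) (g : P ⟶ A) (h : A ⟶ K⟦(1 : ℤ)⟧),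
    XiProjective S P ∧ Triangle.mk f g h ∈ S

/-- The objects admitting a complete resolution by triangles in `S` with middle terms in
`X` which are `Hom(-, Y)`-exact; `GClass S X X` is the Gorenstein category `𝒢(X)` and
`GClass S (XiProjective S) (XiProjective S)` is the class of `ξ`-Gorenstein projectives. -/
def GClass (S : Set (Triangle C)) (X Y : C → Prop) (A : C) : Prop :=
  ∃ (K P : ℤ → C) (f : ∀ n : ℤ, K (n + 1) ⟶ P n) (g : ∀ n : ℤ, P n ⟶ K n)
    (h : ∀ n : ℤ, K n ⟶ (K (n + 1))⟦(1 : ℤ)⟧),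
    K 0 = A ∧ ∀ n : ℤ, X (P n) ∧ Triangle.mk (f n) (g n) (h n) ∈ S ∧
      ∀ Q : C, Y Q → ContraExact (Triangle.mk (f n) (g n) (h n)) Q

/-- `ξ`-Gorenstein projective objects. -/
def GProjective (S : Set (Triangle C)) (A : C) : Prop :=
  GClass S (XiProjective S) (XiProjective S) A

/-- A `ξ`-exact resolution `⋯ → X₁ → X₀ → A → 0` with terms satisfying `X`, which is
`Hom(-, Q)`-exact for every `Q` satisfying `Y`. -/
def HasResolution (S : Set (Triangle C)) (X Y : C → Prop) (A : C) : Prop :=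
  ∃ (K G : ℕ → C) (f : ∀ n : ℕ, K (n + 1) ⟶ G n) (g : ∀ n : ℕ, G n ⟶ K n)
    (h : ∀ n : ℕ, K n ⟶ (K (n + 1))⟦(1 : ℤ)⟧),
    K 0 = A ∧ ∀ n : ℕ, X (G n) ∧ Triangle.mk (f n) (g n) (h n) ∈ S ∧
      ∀ Q : C, Y Q → ContraExact (Triangle.mk (f n) (g n) (h n)) Q

/-- A `ξ`-exact coresolution `0 → A → X⁰ → X¹ → ⋯` with terms satisfying `X`, which is
`Hom(-, Q)`-exact for every `Q` satisfying `Y`. -/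
def HasCoresolution (S : Set (Triangle C)) (X Y : C → Prop) (A : C) : Prop :=
  ∃ (K G : ℕ → C) (f : ∀ n : ℕ, K n ⟶ G n) (g : ∀ n : ℕ, G n ⟶ K (n + 1))
    (h : ∀ n : ℕ, K (n + 1) ⟶ (K n)⟦(1 : ℤ)⟧),
    K 0 = A ∧ ∀ n : ℕ, X (G n) ∧ Triangle.mk (f n) (g n) (h n) ∈ S ∧
      ∀ Q : C, Y Q → ContraExact (Triangle.mk (f n) (g n) (h n)) Q

/-- A finite `ξ`-exact sequence `0 → Gₙ → ⋯ → G₀ → A → 0` where the `j`-th term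
satisfies the predicate `X j`. -/
def FiniteRes (S : Set (Triangle C)) (n : ℕ) (X : ℕ → C → Prop) (A : C) : Prop :=
  ∃ (K G : ℕ → C) (f : ∀ j : ℕ, K (j + 1) ⟶ G j) (g : ∀ j : ℕ, G j ⟶ K j)
    (h : ∀ j : ℕ, K j ⟶ (K (j + 1))⟦(1 : ℤ)⟧),
    K 0 = A ∧ IsZero (K (n + 1)) ∧
    ∀ j ≤ n, X j (G j) ∧ Triangle.mk (f j) (g j) (h j) ∈ S

/-- `ξ`-Gorenstein projective dimension of `A` is at most `n`. -/
def GpdLE (S : Set (Triangle C)) (A : C) (n : ℕ) : Prop :=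
  FiniteRes S n (fun _ => GProjective S) A

section Distinguished

variable {X Y Z : C} {f : X ⟶ Y} {g : Y ⟶ Z} {h : Z ⟶ X⟦(1 : ℤ)⟧}

lemma dist_rotate (hd : Triangle.mk f g h ∈ (distinguishedTriangles : Set (Triangle C))) :
    Triangle.mk g h (-f⟦(1 : ℤ)⟧') ∈ (distinguishedTriangles : Set (Triangle C)) :=
  rot_of_distTriang _ hd

lemma dist_comp_eq_zero (hd : Triangle.mk f g h ∈ (distinguishedTriangles : Set (Triangle C))) :
    g ≫ h = 0 :=
  comp_distTriang_mor_zero₂₃ _ hd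

lemma dist_desc₂ (hd : Triangle.mk f g h ∈ (distinguishedTriangles : Set (Triangle C))) {T : C}
    (φ : Y ⟶ T) (hφ : f ≫ φ = 0) : ∃ ψ : Z ⟶ T, φ = g ≫ ψ :=
  Triangle.yoneda_exact₂ _ hd φ hφ

lemma dist_desc₃ (hd : Triangle.mk f g h ∈ (distinguishedTriangles : Set (Triangle C))) {T : C}
    (φ : Z ⟶ T) (hφ : g ≫ φ = 0) : ∃ ψ : X⟦(1 : ℤ)⟧ ⟶ T, φ = h ≫ ψ :=
  Triangle.yoneda_exact₃ _ hd φ hφ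

lemma dist_lift₂ (hd : Triangle.mk f g h ∈ (distinguishedTriangles : Set (Triangle C))) {T : C}
    (φ : T ⟶ Y) (hφ : φ ≫ g = 0) : ∃ ψ : T ⟶ X, φ = ψ ≫ f :=
  Triangle.coyoneda_exact₂ _ hd φ hφ

lemma dist_lift₃ (hd : Triangle.mk f g h ∈ (distinguishedTriangles : Set (Triangle C))) {T : C}
    (φ : T ⟶ Z) (hφ : φ ≫ h = 0) : ∃ ψ : T ⟶ Y, φ = ψ ≫ g :=
  Triangle.coyoneda_exact₃ _ hd φ hφ

lemma dist_morphism₂ {X' Y' Z' : C} {f' : X' ⟶ Y'} {g' : Y' ⟶ Z'} {h' : Z' ⟶ X'⟦(1 : ℤ)⟧}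
    (hd : Triangle.mk f g h ∈ (distinguishedTriangles : Set (Triangle C)))
    (hd' : Triangle.mk f' g' h' ∈ (distinguishedTriangles : Set (Triangle C)))
    (x : X ⟶ X') (z : Z ⟶ Z') (hxz : h ≫ x⟦(1 : ℤ)⟧' = z ≫ h') :
    ∃ y : Y ⟶ Y', f ≫ y = x ≫ f' ∧ g ≫ z = y ≫ g' :=
  complete_distinguished_triangle_morphism₂ _ _ hd hd' x z hxz

lemma dist_nonempty_iso {Y' : C} {f' : X ⟶ Y'} {g' : Y' ⟶ Z}
    (hd : Triangle.mk f g h ∈ (distinguishedTriangles : Set (Triangle C)))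
    (hd' : Triangle.mk f' g' h ∈ (distinguishedTriangles : Set (Triangle C))) :
    Nonempty (Triangle.mk f g h ≅ Triangle.mk f' g' h) := by
  refine ⟨isoTriangleOfIso₁₃ _ _ hd hd' (Iso.refl X) (Iso.refl Z) ?_⟩
  change h ≫ (𝟙 X)⟦(1 : ℤ)⟧' = 𝟙 Z ≫ h
  rw [CategoryTheory.Functor.map_id, Category.comp_id, Category.id_comp]

end Distinguished

/-- A morphism is `ξ`-phantom if it is killed by precomposition with every morphism from a
`ξ`-projective object. -/
def Ghost (S : Set (Triangle C)) {X Y : C} (k : X ⟶ Y) : Prop :=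
  ∀ P : C, XiProjective S P → ∀ φ : P ⟶ X, φ ≫ k = 0

/-- A morphism is `ξ`-cophantom if it is killed by postcomposition with every morphism to a
`ξ`-projective object. -/
def CoGhost (S : Set (Triangle C)) {X Y : C} (k : X ⟶ Y) : Prop :=
  ∀ Q : C, XiProjective S Q → ∀ φ : Y ⟶ Q, k ≫ φ = 0

section Ghost

variable {S : Set (Triangle C)} {X Y Z : C}

lemma Ghost.comp_left {k : Y ⟶ Z} (hk : Ghost S k) (f : X ⟶ Y) : Ghost S (f ≫ k) := by
  intro P hP φ
  rw [← Category.assoc]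
  exact hk P hP _

lemma Ghost.comp_right {k : X ⟶ Y} (hk : Ghost S k) (f : Y ⟶ Z) : Ghost S (k ≫ f) := by
  intro P hP φ
  rw [← Category.assoc, hk P hP, zero_comp]

lemma CoGhost.comp_left {k : Y ⟶ Z} (hk : CoGhost S k) (f : X ⟶ Y) : CoGhost S (f ≫ k) := by
  intro P hP φ
  rw [Category.assoc, hk P hP, comp_zero]

lemma CoGhost.comp_right {k : X ⟶ Y} (hk : CoGhost S k) (f : Y ⟶ Z) : CoGhost S (k ≫ f) := by
  intro P hP φ
  rw [Category.assoc]
  exact hk P hP _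

lemma ghost_mor₃ (hS : IsProperClass S) {T : Triangle C} (hT : T ∈ S) : Ghost S T.mor₃ := by
  intro P hP φ
  obtain ⟨χ, rfl⟩ := (hP T hT).2.2 φ
  dsimp only
  rw [Category.assoc, comp_distTriang_mor_zero₂₃ _ (hS.subset_dist hT), comp_zero]

end Ghost

section Projective

variable {S : Set (Triangle C)} (hS : IsProperClass S)

include hS

lemma comp_shift_mor₃_eq_zero {Q : C} {T : Triangle C} (hT : T ∈ S)
    (H : ∀ T ∈ S, ∀ φ : Q ⟶ T.obj₃, φ ≫ T.mor₃ = 0) (φ : Q ⟶ T.obj₃⟦(-1 : ℤ)⟧) :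
    φ ≫ T.mor₃⟦(-1 : ℤ)⟧' = 0 := by
  have : φ ≫ ((-1 : ℤ).negOnePow • T.mor₃⟦(-1 : ℤ)⟧' ≫
      (shiftFunctorComm C 1 (-1)).hom.app T.obj₁) = 0 :=
    H _ (hS.susp_closed T hT (-1)) φ
  rw [Linear.comp_units_smul, smul_eq_zero_iff_eq, ← Category.assoc] at this
  exact (cancel_mono _).1 (this.trans zero_comp.symm)

lemma xiProjective_of_comp_mor₃ {Q : C} (H : ∀ T ∈ S, ∀ φ : Q ⟶ T.obj₃, φ ≫ T.mor₃ = 0) :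
    XiProjective S Q := by
  intro T hT
  have hd := hS.subset_dist hT
  refine ⟨fun φ ψ hφψ => ?_, fun φ hφ => T.coyoneda_exact₂ hd φ hφ, fun φ => ?_⟩
  · have hφψ : φ ≫ T.mor₁ = ψ ≫ T.mor₁ := hφψ
    obtain ⟨χ, hχ⟩ := dist_lift₂ (inv_rot_of_distTriang _ hd) (φ - ψ)
      (by rw [Preadditive.sub_comp, hφψ, sub_self])
    let u : (T.obj₁⟦(1 : ℤ)⟧)⟦(-1 : ℤ)⟧ ⟶ T.obj₁ := (shiftEquiv C (1 : ℤ)).unitIso.inv.app T.obj₁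
    rw [← sub_eq_zero, hχ]
    change χ ≫ (-(T.mor₃⟦(-1 : ℤ)⟧' ≫ u)) = 0
    rw [Preadditive.comp_neg, ← Category.assoc, comp_shift_mor₃_eq_zero hS hT H χ, zero_comp,
      neg_zero]
  · obtain ⟨χ, hχ⟩ := T.coyoneda_exact₃ hd φ (H T hT φ)
    exact ⟨χ, hχ.symm⟩

lemma xiProjective_of_ghost_eq_zero {Q : C}
    (H : ∀ (Y : C) (k : Q ⟶ Y), Ghost S k → k = 0) : XiProjective S Q :=
  xiProjective_of_comp_mor₃ hS fun _ hT φ => H _ _ ((ghost_mor₃ hS hT).comp_left φ)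

lemma XiProjective.shift {Q : C} (hQ : XiProjective S Q) : XiProjective S (Q⟦(1 : ℤ)⟧) := by
  refine xiProjective_of_comp_mor₃ hS fun T hT φ => (shiftFunctor C (-1 : ℤ)).map_injective ?_
  let e : Q ≅ (Q⟦(1 : ℤ)⟧)⟦(-1 : ℤ)⟧ := (shiftEquiv C (1 : ℤ)).unitIso.app Q
  have := comp_shift_mor₃_eq_zero hS hT (fun T hT φ => ghost_mor₃ hS hT Q hQ φ)
    (e.hom ≫ φ⟦(-1 : ℤ)⟧')
  rw [Functor.map_comp, Functor.map_zero, ← cancel_epi e.hom, ← Category.assoc, this, comp_zero]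

lemma xiProjective_of_isZero {Q : C} (hQ : IsZero Q) : XiProjective S Q :=
  xiProjective_of_ghost_eq_zero hS fun _ _ _ => hQ.eq_of_src _ _

lemma mem_of_ghost (hE : HasEnoughXiProjectives S) {T : Triangle C}
    (hT : T ∈ (distinguishedTriangles : Set (Triangle C))) (hg : Ghost S T.mor₃) : T ∈ S := by
  obtain ⟨K, P, f, g, h, hP, hK⟩ := hE T.obj₃
  obtain ⟨u, (hu : T.mor₃ = h ≫ u)⟩ :=
    dist_desc₃ (hS.subset_dist hK) T.mor₃ (hg P hP g)
  obtain ⟨v, rfl⟩ := (shiftFunctor C (1 : ℤ)).map_surjective u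
  obtain ⟨F, f', g', h', β, hF, -, -, (hh : h ≫ v⟦(1 : ℤ)⟧' = h')⟩ := hS.cobase_change _ hK v
  obtain rfl : T.mor₃ = h' := hu.trans hh
  exact hS.iso_closed _ _ (dist_nonempty_iso (hS.subset_dist hF) hT) hF

lemma contraExact_of_coGhost {T : Triangle C}
    (hT : T ∈ (distinguishedTriangles : Set (Triangle C))) (hg : CoGhost S T.mor₃)
    {Q : C} (hQ : XiProjective S Q) : ContraExact T Q := by
  refine ⟨fun φ ψ hφψ => ?_, fun φ hφ => T.yoneda_exact₂ hT φ hφ, fun φ => ?_⟩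
  · have hφψ : T.mor₂ ≫ φ = T.mor₂ ≫ ψ := hφψ
    obtain ⟨χ, hχ⟩ := T.yoneda_exact₃ hT (φ - ψ) (by rw [Preadditive.comp_sub, hφψ, sub_self])
    rw [← sub_eq_zero, hχ, hg Q hQ]
  · obtain ⟨χ, hχ⟩ := dist_desc₃ (dist_rotate hT) (φ⟦(1 : ℤ)⟧') (hg _ (hQ.shift hS) _)
    obtain ⟨χ, rfl⟩ := (shiftFunctor C (1 : ℤ)).map_surjective χ
    refine ⟨-χ, (shiftFunctor C (1 : ℤ)).map_injective ?_⟩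
    change (shiftFunctor C (1 : ℤ)).map (T.mor₁ ≫ (-χ)) = _
    rw [hχ, Preadditive.comp_neg, Functor.map_neg, Functor.map_comp, Preadditive.neg_comp]

end Projective

lemma coGhost_mor₃ {S : Set (Triangle C)} {T : Triangle C}
    (hT : T ∈ (distinguishedTriangles : Set (Triangle C)))
    (H : ∀ Q : C, XiProjective S Q → ContraExact T Q) : CoGhost S T.mor₃ := by
  intro Q hQ φ
  refine (H Q hQ).1 ?_
  dsimp only
  rw [← Category.assoc, comp_distTriang_mor_zero₂₃ _ hT, zero_comp, comp_zero]

/-- `A` is a syzygy of `B`: there is a triangle `A ⟶ P ⟶ B ⟶ ΣA` in `ξ` with `P`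
`ξ`-projective which is `Hom(-, 𝒫(ξ))`-exact. -/
def IsSyzygy (S : Set (Triangle C)) (A B : C) : Prop :=
  ∃ (P : C) (f : A ⟶ P) (g : P ⟶ B) (h : B ⟶ A⟦(1 : ℤ)⟧), XiProjective S P ∧
    Triangle.mk f g h ∈ (distinguishedTriangles : Set (Triangle C)) ∧ Ghost S h ∧ CoGhost S h

section GProjective

variable {S : Set (Triangle C)} (hS : IsProperClass S)

include hS

lemma gProjective_iff (hE : HasEnoughXiProjectives S) (X : C) :
    GProjective S X ↔ ∃ K : ℤ → C, K 0 = X ∧ ∀ n : ℤ, IsSyzygy S (K (n + 1)) (K n) := by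
  constructor
  · rintro ⟨K, P, f, g, h, h₀, H⟩
    refine ⟨K, h₀, fun n => ⟨P n, f n, g n, h n, (H n).1, hS.subset_dist (H n).2.1,
      ghost_mor₃ hS (H n).2.1, coGhost_mor₃ (hS.subset_dist (H n).2.1) (H n).2.2⟩⟩
  · rintro ⟨K, h₀, H⟩
    choose P f g h hP hd hg hc using H
    exact ⟨K, P, f, g, h, h₀, fun n => ⟨hP n, mem_of_ghost hS hE (hd n) (hg n),
      fun Q hQ => contraExact_of_coGhost hS (hd n) (hc n) hQ⟩⟩

lemma GProjective.exists_isSyzygy_left (hE : HasEnoughXiProjectives S) {X : C}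
    (hX : GProjective S X) : ∃ A, GProjective S A ∧ IsSyzygy S A X := by
  obtain ⟨K, rfl, H⟩ := (gProjective_iff hS hE X).1 hX
  exact ⟨K (0 + 1), (gProjective_iff hS hE _).2 ⟨fun n => K (n + 1), rfl, fun n => H (n + 1)⟩,
    H 0⟩

lemma GProjective.exists_isSyzygy_right (hE : HasEnoughXiProjectives S) {X : C}
    (hX : GProjective S X) : ∃ B, GProjective S B ∧ IsSyzygy S X B := by
  obtain ⟨K, rfl, H⟩ := (gProjective_iff hS hE X).1 hX
  refine ⟨K (0 - 1), (gProjective_iff hS hE _).2 ⟨fun n => K (n - 1), rfl, fun n => ?_⟩, ?_⟩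
  · simpa only [sub_add_cancel, add_sub_cancel_right] using H (n - 1)
  · simpa only [sub_add_cancel] using H (0 - 1)

lemma gProjective_of_closed (hE : HasEnoughXiProjectives S) (W : C → Prop)
    (hl : ∀ X, W X → ∃ A, W A ∧ IsSyzygy S A X) (hr : ∀ X, W X → ∃ B, W B ∧ IsSyzygy S X B)
    {X : C} (hX : W X) : GProjective S X := by
  choose l hlW hl using fun X : Subtype W => hl X.1 X.2
  choose r hrW hr using fun X : Subtype W => hr X.1 X.2
  let L : ℕ → Subtype W := fun n => Nat.rec ⟨X, hX⟩ (fun _ Y => ⟨l Y, hlW Y⟩) n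
  let R : ℕ → Subtype W := fun n => Nat.rec ⟨X, hX⟩ (fun _ Y => ⟨r Y, hrW Y⟩) n
  let K : ℤ → C := fun n => match n with
    | Int.ofNat m => (L m).1
    | Int.negSucc m => (R (m + 1)).1
  refine (gProjective_iff hS hE X).2 ⟨K, rfl, fun n => ?_⟩
  match n with
  | Int.ofNat m => exact hl (L m)
  | Int.negSucc 0 => exact hr (R 0)
  | Int.negSucc (m + 1) => exact hr (R (m + 1))

open ZeroObject in
lemma XiProjective.gProjective (hE : HasEnoughXiProjectives S) {P : C} (hP : XiProjective S P) :
    GProjective S P := by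
  refine gProjective_of_closed hS hE (XiProjective S) (fun X hX => ?_) (fun X hX => ?_) hP
  · refine ⟨(0 : C), xiProjective_of_isZero hS (isZero_zero C), X, 0, 𝟙 X, 0, hX,
      contractible_distinguished₁ X, fun _ _ _ => comp_zero, fun _ _ _ => zero_comp⟩
  · refine ⟨(0 : C), xiProjective_of_isZero hS (isZero_zero C), X, 𝟙 X, 0, 0, hX,
      contractible_distinguished X, fun _ _ _ => comp_zero, fun _ _ _ => zero_comp⟩

lemma GProjective.ghost_eq_zero (hE : HasEnoughXiProjectives S) {X Q : C}
    (hX : GProjective S X) (hQ : XiProjective S Q) {k : X ⟶ Q} (hk : Ghost S k) : k = 0 := by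
  obtain ⟨A, -, P, f, g, h, hP, hd, -, hc⟩ := hX.exists_isSyzygy_left hS hE
  obtain ⟨u, (rfl : k = h ≫ u)⟩ := dist_desc₃ hd k (hk P hP g)
  exact hc Q hQ u

end GProjective

section Split

lemma exists_splitting {A E R : C} {a : A ⟶ E} {b : E ⟶ R} {k : R ⟶ A⟦(1 : ℤ)⟧}
    (hd : Triangle.mk a b k ∈ (distinguishedTriangles : Set (Triangle C))) (hk : k = 0) :
    ∃ (r : E ⟶ A) (s : R ⟶ E),
      a ≫ r = 𝟙 A ∧ s ≫ b = 𝟙 R ∧ s ≫ r = 0 ∧ r ≫ a + b ≫ s = 𝟙 E := by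
  obtain ⟨e, ha, hb⟩ := exists_iso_binaryBiproduct_of_distTriang _ hd hk
  change E ≅ A ⊞ R at e
  change a ≫ e.hom = biprod.inl at ha
  change b = e.hom ≫ biprod.snd at hb
  have ha' : a = biprod.inl ≫ e.inv := by rw [← ha, Category.assoc, e.hom_inv_id, Category.comp_id]
  refine ⟨e.hom ≫ biprod.fst, biprod.inr ≫ e.inv, ?_, ?_, ?_, ?_⟩
  · rw [reassoc_of% ha, biprod.inl_fst]
  · simp [hb]
  · simp
  · rw [← cancel_epi e.inv, ← cancel_mono e.hom, ha', hb]
    simp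

variable {S : Set (Triangle C)} (hS : IsProperClass S) {A E R : C} {a : A ⟶ E} {b : E ⟶ R}
  {r : E ⟶ A} {s : R ⟶ E}

include hS

lemma IsSyzygy.of_splitting_left (h₁ : a ≫ r = 𝟙 A) (h₃ : s ≫ r = 0)
    (h₄ : r ≫ a + b ≫ s = 𝟙 E) (hR : XiProjective S R) {K : C} (hK : IsSyzygy S K A) :
    IsSyzygy S K E := by
  obtain ⟨P, i, p, l, hP, hd, hg, hc⟩ := hK
  obtain ⟨X, y, z, hX⟩ := distinguished_cocone_triangle₂ (r ≫ l)
  obtain ⟨t, (hiy : i ≫ t = 𝟙 _ ≫ y), (hpz : p ≫ a = t ≫ z)⟩ :=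
    dist_morphism₂ hd hX (𝟙 _) a (by
        rw [CategoryTheory.Functor.map_id, Category.comp_id, reassoc_of% h₁])
  obtain ⟨u, (hu : s = u ≫ z)⟩ :=
    dist_lift₃ hX s (by rw [reassoc_of% h₃, zero_comp])
  rw [Category.id_comp] at hiy
  refine ⟨X, y, z, r ≫ l, ?_, hX, hg.comp_left r, hc.comp_left r⟩
  refine xiProjective_of_ghost_eq_zero hS fun Y κ hκ => ?_
  obtain ⟨ψ, (hψ : κ = z ≫ ψ)⟩ := dist_desc₂ hX κ (by
    rw [← hiy, Category.assoc, hκ P hP, comp_zero])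
  obtain ⟨χ, (hχ : a ≫ ψ = l ≫ χ)⟩ := dist_desc₃ hd (a ≫ ψ) (by
    rw [reassoc_of% hpz, ← hψ, hκ P hP])
  have hsψ : s ≫ ψ = 0 := by rw [hu, Category.assoc, ← hψ, hκ R hR]
  have hψ' : ψ = (r ≫ l) ≫ χ := by
    rw [← Category.id_comp ψ, ← h₄, Preadditive.add_comp, Category.assoc, Category.assoc, hχ, hsψ,
      comp_zero, add_zero, Category.assoc]
  have hzk : z ≫ r ≫ l = 0 := dist_comp_eq_zero hX
  rw [hψ, hψ', ← Category.assoc, hzk, zero_comp]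

lemma IsSyzygy.of_splitting_right (h₂ : s ≫ b = 𝟙 R) (h₄ : r ≫ a + b ≫ s = 𝟙 E)
    (hA : XiProjective S A) {L : C} (hL : IsSyzygy S R L) : IsSyzygy S E L := by
  obtain ⟨P, j, q, c, hP, hd, hg, hc⟩ := hL
  obtain ⟨X, y, z, hX⟩ := distinguished_cocone_triangle₂ (c ≫ s⟦(1 : ℤ)⟧')
  obtain ⟨t, (hjt : j ≫ t = s ≫ y), (hqt : q ≫ 𝟙 _ = t ≫ z)⟩ :=
    dist_morphism₂ hd hX s (𝟙 _) (Category.id_comp _).symm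
  rw [Category.comp_id] at hqt
  refine ⟨X, y, z, c ≫ s⟦(1 : ℤ)⟧', ?_, hX, hg.comp_right _, hc.comp_right _⟩
  refine xiProjective_of_ghost_eq_zero hS fun Y κ hκ => ?_
  obtain ⟨ψ, (hψ : κ = z ≫ ψ)⟩ := dist_desc₂ hX κ (by
    rw [← Category.id_comp y, ← h₄, Preadditive.add_comp, Preadditive.add_comp, Category.assoc,
      Category.assoc, Category.assoc, Category.assoc, ← Category.assoc a, hκ A hA,
      ← Category.assoc s, ← hjt, Category.assoc, hκ P hP, comp_zero, comp_zero, comp_zero, add_zero])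
  obtain ⟨χ, (hχ : ψ = c ≫ χ)⟩ := dist_desc₃ hd ψ (by
    rw [hqt, Category.assoc, ← hψ, hκ P hP])
  have hc' : c = (c ≫ s⟦(1 : ℤ)⟧') ≫ b⟦(1 : ℤ)⟧' := by
    rw [Category.assoc, ← Functor.map_comp, h₂, CategoryTheory.Functor.map_id, Category.comp_id]
  have hzk : z ≫ c ≫ s⟦(1 : ℤ)⟧' = 0 := dist_comp_eq_zero hX
  rw [hψ, hχ, hc', ← Category.assoc, ← Category.assoc, hzk, zero_comp, zero_comp]

end Split

lemma exists_distinguished_of_shift {U W V : C} {m₁ : U⟦(1 : ℤ)⟧ ⟶ W⟦(1 : ℤ)⟧}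
    {m₃ : W⟦(1 : ℤ)⟧ ⟶ V⟦(1 : ℤ)⟧} (k : V ⟶ U⟦(1 : ℤ)⟧)
    (hm : Triangle.mk m₁ m₃ (-k⟦(1 : ℤ)⟧') ∈ (distinguishedTriangles : Set (Triangle C))) :
    ∃ (p : U ⟶ W) (q : W ⟶ V),
      Triangle.mk p q k ∈ (distinguishedTriangles : Set (Triangle C)) := by
  obtain ⟨W', p, q, hd⟩ := distinguished_cocone_triangle₂ k
  obtain ⟨e⟩ := dist_nonempty_iso (dist_rotate (dist_rotate (dist_rotate hd))) hm
  let ε : W' ≅ W := (shiftFunctor C (1 : ℤ)).preimageIso (Triangle.π₂.mapIso e)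
  refine ⟨p ≫ ε.hom, ε.inv ≫ q, isomorphic_distinguished _ hd _ ?_⟩
  exact Triangle.isoMk _ _ (Iso.refl _) ε.symm (Iso.refl _)
    (by change (p ≫ ε.hom) ≫ ε.inv = 𝟙 _ ≫ p; simp)
    (by change (ε.inv ≫ q) ≫ 𝟙 _ = ε.inv ≫ q; simp)
    (by change k ≫ (𝟙 U)⟦(1 : ℤ)⟧' = 𝟙 _ ≫ k; simp)

variable [IsTriangulated C]

section Octahedral

lemma fibre_octahedron (S : Set (Triangle C)) {X₁ X₂ X₃ U V W : C} {u₁₂ : X₁ ⟶ X₂}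
    {u₂₃ : X₂ ⟶ X₃} {i : U ⟶ X₁} {a : X₂ ⟶ U⟦(1 : ℤ)⟧} {j : V ⟶ X₂} {b : X₃ ⟶ V⟦(1 : ℤ)⟧}
    {l : W ⟶ X₁} {c : X₃ ⟶ W⟦(1 : ℤ)⟧}
    (h₁₂ : Triangle.mk i u₁₂ a ∈ (distinguishedTriangles : Set (Triangle C)))
    (h₂₃ : Triangle.mk j u₂₃ b ∈ (distinguishedTriangles : Set (Triangle C)))
    (h₁₃ : Triangle.mk l (u₁₂ ≫ u₂₃) c ∈ (distinguishedTriangles : Set (Triangle C))) :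
    (Ghost S a → Ghost S b → Ghost S c) ∧ (CoGhost S a → CoGhost S b → CoGhost S c) ∧
    ∃ (p : U ⟶ W) (q : W ⟶ V),
      Triangle.mk p q (j ≫ a) ∈ (distinguishedTriangles : Set (Triangle C)) := by
  have H := Triangulated.someOctahedron rfl (dist_rotate h₁₂) (dist_rotate h₂₃)
    (dist_rotate h₁₃)
  obtain ⟨m₁, m₃, e₁, e₂, e₃, -, mem⟩ := H
  refine ⟨fun ha hb P hP φ => ?_, fun ha hb Q hQ φ => ?_, ?_⟩
  · obtain ⟨χ, (rfl : φ = χ ≫ u₂₃)⟩ := dist_lift₃ h₂₃ φ (hb P hP φ)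
    rw [Category.assoc, ← e₁, ← Category.assoc, ha P hP, zero_comp]
  · obtain ⟨χ, hχ⟩ := dist_desc₃ (dist_rotate h₁₂) (m₁ ≫ φ) (by
      exact ha Q hQ _)
    obtain ⟨ρ, hρ⟩ := dist_desc₂ mem (φ - (-l⟦(1 : ℤ)⟧') ≫ χ) (by
      rw [Preadditive.comp_sub, hχ, reassoc_of% e₂, sub_self])
    have hcl : c ≫ (-l⟦(1 : ℤ)⟧') = 0 :=
      dist_comp_eq_zero (dist_rotate h₁₃)
    rw [sub_eq_iff_eq_add.1 hρ, Preadditive.comp_add, reassoc_of% e₃, hb Q hQ, reassoc_of% hcl,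
      zero_comp, add_zero]
  · refine exists_distinguished_of_shift (m₁ := m₁) (m₃ := m₃) _ ?_
    rwa [Functor.map_comp, ← Preadditive.neg_comp]

lemma exists_pullback {A B R D X : C} {f : A ⟶ B} {g : B ⟶ X} {h : X ⟶ A⟦(1 : ℤ)⟧} {j : D ⟶ R}
    {q : R ⟶ X} {c : X ⟶ D⟦(1 : ℤ)⟧}
    (hd : Triangle.mk f g h ∈ (distinguishedTriangles : Set (Triangle C)))
    (hd' : Triangle.mk j q c ∈ (distinguishedTriangles : Set (Triangle C))) :
    ∃ (E : C) (α : A ⟶ E) (β : E ⟶ R) (γ : D ⟶ E) (δ : E ⟶ B),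
      Triangle.mk α β (q ≫ h) ∈ (distinguishedTriangles : Set (Triangle C)) ∧
      Triangle.mk γ δ (g ≫ c) ∈ (distinguishedTriangles : Set (Triangle C)) := by
  obtain ⟨E, α, β, hE⟩ := distinguished_cocone_triangle₂ (q ≫ h)
  obtain ⟨-, -, γ, δ, hγ⟩ :=
    fibre_octahedron ∅ hd' (dist_rotate hd) (dist_rotate hE)
  exact ⟨E, α, β, γ, δ, hE, hγ⟩

lemma exists_pushout {A B X P L : C} {f : A ⟶ B} {g : B ⟶ X} {h : X ⟶ A⟦(1 : ℤ)⟧} {i : A ⟶ P}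
    {p : P ⟶ L} {l : L ⟶ A⟦(1 : ℤ)⟧}
    (hd : Triangle.mk f g h ∈ (distinguishedTriangles : Set (Triangle C)))
    (hd' : Triangle.mk i p l ∈ (distinguishedTriangles : Set (Triangle C))) :
    ∃ (F : C) (α : P ⟶ F) (β : F ⟶ X) (γ : B ⟶ F) (δ : F ⟶ L),
      Triangle.mk α β (h ≫ (-i⟦(1 : ℤ)⟧')) ∈ (distinguishedTriangles : Set (Triangle C)) ∧
      Triangle.mk γ δ (l ≫ (-f⟦(1 : ℤ)⟧')) ∈ (distinguishedTriangles : Set (Triangle C)) := by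
  obtain ⟨F, α, β, hF⟩ := distinguished_cocone_triangle₂ (h ≫ (-i⟦(1 : ℤ)⟧'))
  obtain ⟨-, -, γ, δ, hγ⟩ := fibre_octahedron ∅ (dist_rotate hd)
    (dist_rotate (dist_rotate hd')) (dist_rotate hF)
  exact ⟨F, α, β, γ, δ, hF, hγ⟩

lemma cofibre_octahedron (S : Set (Triangle C)) {X₁ X₂ X₃ U V : C} {u₁₂ : X₁ ⟶ X₂}
    {u₂₃ : X₂ ⟶ X₃} {v₁₂ : X₂ ⟶ U} {a : U ⟶ X₁⟦(1 : ℤ)⟧} {v₂₃ : X₃ ⟶ V} {b : V ⟶ X₂⟦(1 : ℤ)⟧}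
    (h₁₂ : Triangle.mk u₁₂ v₁₂ a ∈ (distinguishedTriangles : Set (Triangle C)))
    (h₂₃ : Triangle.mk u₂₃ v₂₃ b ∈ (distinguishedTriangles : Set (Triangle C)))
    (ha : Ghost S a) (hb : Ghost S b) (ha' : CoGhost S a)
    (hb' : CoGhost S b) :
    ∃ (W : C) (v₁₃ : X₃ ⟶ W) (c : W ⟶ X₁⟦(1 : ℤ)⟧) (p : U ⟶ W) (q : W ⟶ V),
      Triangle.mk (u₁₂ ≫ u₂₃) v₁₃ c ∈ (distinguishedTriangles : Set (Triangle C)) ∧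
      Ghost S c ∧ CoGhost S c ∧
      Triangle.mk p q (b ≫ v₁₂⟦(1 : ℤ)⟧') ∈ (distinguishedTriangles : Set (Triangle C)) := by
  obtain ⟨W, v₁₃, c, h₁₃⟩ := distinguished_cocone_triangle (u₁₂ ≫ u₂₃)
  obtain ⟨m₁, m₃, e₁, e₂, e₃, e₄, mem⟩ := Triangulated.someOctahedron rfl h₁₂ h₂₃ h₁₃
  refine ⟨W, v₁₃, c, m₁, m₃, h₁₃, fun P hP φ => ?_, fun Q hQ φ => ?_, mem⟩
  · obtain ⟨χ, (hχ : φ ≫ m₃ = χ ≫ v₂₃)⟩ := dist_lift₃ h₂₃ (φ ≫ m₃) (hb P hP _)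
    obtain ⟨ρ, (hρ : φ - χ ≫ v₁₃ = ρ ≫ m₁)⟩ := dist_lift₂ mem (φ - χ ≫ v₁₃) (by
      rw [Preadditive.sub_comp, hχ, Category.assoc, e₃, sub_self])
    have hvc : v₁₃ ≫ c = 0 := dist_comp_eq_zero h₁₃
    rw [sub_eq_iff_eq_add.1 hρ, Preadditive.add_comp, Category.assoc, e₂, ha P hP, Category.assoc,
      hvc, comp_zero, add_zero]
  · obtain ⟨χ, (hχ : φ = (-u₁₂⟦(1 : ℤ)⟧') ≫ χ)⟩ :=
      dist_desc₃ (dist_rotate h₁₂) φ (ha' Q hQ φ)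
    have e₄' : c ≫ u₁₂⟦(1 : ℤ)⟧' = m₃ ≫ b := e₄
    have hcφ : c ≫ φ = -(m₃ ≫ b ≫ χ) := by
      rw [hχ, Preadditive.neg_comp, Preadditive.comp_neg, reassoc_of% e₄']
    rw [hcφ, hb' Q hQ, comp_zero, neg_zero]

end Octahedral

/-- `B` is an extension, along a triangle in `ξ`, of `ξ`-Gorenstein projective objects. -/
def IsGExtension (S : Set (Triangle C)) (B : C) : Prop :=
  ∃ (A X : C) (f : A ⟶ B) (g : B ⟶ X) (h : X ⟶ A⟦(1 : ℤ)⟧),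
    Triangle.mk f g h ∈ (distinguishedTriangles : Set (Triangle C)) ∧ Ghost S h ∧
    GProjective S A ∧ GProjective S X

section Extension

variable {S : Set (Triangle C)} (hS : IsProperClass S) (hE : HasEnoughXiProjectives S)

include hS hE

lemma IsGExtension.exists_isSyzygy_left {B : C} (hB : IsGExtension S B) :
    ∃ W, IsGExtension S W ∧ IsSyzygy S W B := by
  obtain ⟨A, X, f, g, h, hd, hg, hA, hX⟩ := hB
  obtain ⟨A₁, hA₁, hAS⟩ := hA.exists_isSyzygy_left hS hE
  obtain ⟨X₁, hX₁, R, j, q, c, hR, hXd, hXg, hXc⟩ := hX.exists_isSyzygy_left hS hE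
  obtain ⟨E, α, β, γ, δ, hα, hγ⟩ := exists_pullback hd hXd
  obtain ⟨r, s, h₁, -, h₃, h₄⟩ := exists_splitting hα (hg R hR q)
  obtain ⟨P, y, z, k, hP, hy, hk, hk'⟩ := hAS.of_splitting_left hS h₁ h₃ h₄ hR
  obtain ⟨W, l, w, hW⟩ := distinguished_cocone_triangle₁ (z ≫ δ)
  obtain ⟨hw, hw', p, q', hp⟩ := fibre_octahedron S hy hγ hW
  exact ⟨W, ⟨A₁, X₁, p, q', γ ≫ k, hp, hk.comp_left γ, hA₁, hX₁⟩, P, l, z ≫ δ, w, hP, hW,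
    hw hk (hXg.comp_left g), hw' hk' (hXc.comp_left g)⟩

lemma IsGExtension.exists_isSyzygy_right {B : C} (hB : IsGExtension S B) :
    ∃ W, IsGExtension S W ∧ IsSyzygy S B W := by
  obtain ⟨A, X, f, g, h, hd, hg, hA, hX⟩ := hB
  obtain ⟨A', hA', P, i, p, l, hP, hAd, hAg, hAc⟩ := hA.exists_isSyzygy_right hS hE
  obtain ⟨X', hX', hXS⟩ := hX.exists_isSyzygy_right hS hE
  obtain ⟨F, α, β, γ, δ, hα, hγ⟩ := exists_pushout hd hAd
  obtain ⟨r, s, -, h₂, -, h₄⟩ := exists_splitting hα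
    (hX.ghost_eq_zero hS hE (hP.shift hS) (hg.comp_right _))
  obtain ⟨Q, y, z, k, hQ, hy, hk, hk'⟩ := hXS.of_splitting_right hS h₂ h₄ hP
  obtain ⟨W, v, c, p', q', hW, hc, hc', hp⟩ := cofibre_octahedron S hγ hy
    (hAg.comp_right _) hk (hAc.comp_right _) hk'
  exact ⟨W, ⟨A', X', p', q', _, hp, hk.comp_right _, hA', hX'⟩, Q, _, v, c, hQ, hW, hc, hc'⟩

/-- `𝒢𝒫(ξ)` is closed under extensions along triangles in `ξ`. -/
lemma IsGExtension.gProjective {B : C} (hB : IsGExtension S B) : GProjective S B :=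
  gProjective_of_closed hS hE (IsGExtension S)
    (fun _ h => h.exists_isSyzygy_left hS hE) (fun _ h => h.exists_isSyzygy_right hS hE) hB

end Extension

theorem triangle_gproj_replace (S : Set (Triangle C))
    (hS : IsProperClass S) (hE : HasEnoughXiProjectives S)
    (G₁ G₀ A : C) (f : G₁ ⟶ G₀) (g : G₀ ⟶ A) (h : A ⟶ G₁⟦(1 : ℤ)⟧)
    (hT : Triangle.mk f g h ∈ S) (hG₁ : GProjective S G₁) (hG₀ : GProjective S G₀) :
    (∃ (P G₀' : C) (f' : P ⟶ G₀') (g' : G₀' ⟶ A) (h' : A ⟶ P⟦(1 : ℤ)⟧),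
      Triangle.mk f' g' h' ∈ S ∧ XiProjective S P ∧ GProjective S G₀') ∧
    (∃ (G₁' Q : C) (f' : G₁' ⟶ Q) (g' : Q ⟶ A) (h' : A ⟶ G₁'⟦(1 : ℤ)⟧),
      Triangle.mk f' g' h' ∈ S ∧ GProjective S G₁' ∧ XiProjective S Q) := by
  obtain ⟨L, hL, P, i, p, l, hP, hd, hg, hc⟩ := hG₁.exists_isSyzygy_right hS hE
  have hTd := hS.subset_dist hT
  have hh : Ghost S h := ghost_mor₃ hS hT
  obtain ⟨G, α, β, γ, δ, hα, hγ⟩ := exists_pushout hTd hd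
  have hG : GProjective S G :=
    IsGExtension.gProjective hS hE ⟨G₀, L, γ, δ, _, hγ, hg.comp_right _, hG₀, hL⟩
  have hh' : Ghost S (h ≫ (-i⟦(1 : ℤ)⟧')) := hh.comp_right _
  refine ⟨⟨P, G, α, β, _, mem_of_ghost hS hE hα hh', hP, hG⟩, ?_⟩
  obtain ⟨K, hK, Q, y, z, k, hQ, hy, hk, -⟩ := hG.exists_isSyzygy_left hS hE
  obtain ⟨W, w, c, hW⟩ := distinguished_cocone_triangle₁ (z ≫ β)
  obtain ⟨hw, -, p', q', hp⟩ := fibre_octahedron S hy hα hW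
  exact ⟨W, Q, w, z ≫ β, c, mem_of_ghost hS hE hW (hw hk hh'),
    IsGExtension.gProjective hS hE
      ⟨K, P, p', q', _, hp, hk.comp_left α, hK, hP.gProjective hS hE⟩, hQ⟩

end GorensteinTriangulated
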